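/- Let {s_j : j ∈ J} be a set of representatives of the G-orbits on S, and for each j fix a right coset decomposition G = ∪_{i_j=1}^{k_j} G_{s_j} g_{i_j} with g_1 = 1. Assume each α_{s_j} restricted to G_{s_j} is a normal cocycle and the compatibility conditions α_{s_j g_{i}}(g_{j'}⁻¹ h g_{i}, g_{i}⁻¹ a g_{i}) = α_{s_j g_{i}}(g_{j'}⁻¹ h a h⁻¹ g_{j'}, g_{j'}⁻¹ h g_{i}) hold for all coset representatives g_i, g_{j'}, all h ∈ G_{s_j} and all α_{s_j}-regular a ∈ G_{s_j}. For each j, let L_{1}^{j},...,L_{r_j}^{j} be the α_{s_j}-regular conjugacy classes of G_{s_j}, and set Z(L_t^j) = Σ_{a∈L_t^j} Σ_{i_j=1}^{k_j} (g_{i_j}⁻¹ a g_{i_j}) ⊗ e(s_j·g_{i_j}). Then the collection {Z(L_t^j) : j ∈ J, 1 ≤ t ≤ r_j} is a C-basis of the center Z(A_α(G,S)). -/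

import Mathlib

/-- The multiplication of the generalized twisted double `A_α(G,S)`, realized on
`(G × S) →₀ ℂ` with basis `{g ⊗ e(s)}`:
`(g⊗e(s))·(h⊗e(t)) = α_t(g,h)·(gh ⊗ e(s·h)e(t))`. -/
noncomputable def gtdMul {G S : Type*} [Group G] [Fintype S] [DecidableEq S]
    (act : S → G → S) (α : G → G → S → ℂˣ)
    (a b : (G × S) →₀ ℂ) : (G × S) →₀ ℂ :=
  a.sum fun p c => b.sum fun q d =>
    if act p.2 q.1 = q.2 then
      Finsupp.single (p.1 * q.1, q.2) (c * d * (α p.1 q.1 q.2 : ℂ))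
    else 0

/-- `a` in the stabilizer `G_t` is `α_t`-regular. -/
def IsRegAt {G S : Type*} [Group G] (act : S → G → S) (α : G → G → S → ℂˣ)
    (t : S) (a : G) : Prop :=
  ∀ z : G, act t z = t → z * a = a * z → α a z t = α z a t

lemma act_eq_iff_eq_act_inv {G S : Type*} [Group G] {act : S → G → S}
    (hact1 : ∀ s : S, act s 1 = s) (hact : ∀ (s : S) (g h : G), act (act s g) h = act s (g * h))
    (s t : S) (u : G) : act s u = t ↔ s = act t u⁻¹ := by
  constructor <;> rintro rfl <;> simp [hact, hact1]

section Multiplication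

variable {G S : Type*} [Group G] [Fintype S] [DecidableEq S]
  (act : S → G → S) (α : G → G → S → ℂˣ)

lemma gtdMul_zero_left (b : (G × S) →₀ ℂ) : gtdMul act α 0 b = 0 :=
  Finsupp.sum_zero_index

lemma gtdMul_zero_right (a : (G × S) →₀ ℂ) : gtdMul act α a 0 = 0 := by
  simp [gtdMul]

lemma gtdMul_add_left (a a' b : (G × S) →₀ ℂ) :
    gtdMul act α (a + a') b = gtdMul act α a b + gtdMul act α a' b := by
  classical
  unfold gtdMul
  refine Finsupp.sum_add_index' (fun p => ?_) (fun p c c' => ?_)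
  · simp
  · rw [← Finsupp.sum_add]
    refine Finsupp.sum_congr fun q _ => ?_
    split_ifs
    · rw [← Finsupp.single_add, add_mul, add_mul]
    · simp

lemma gtdMul_add_right (a b b' : (G × S) →₀ ℂ) :
    gtdMul act α a (b + b') = gtdMul act α a b + gtdMul act α a b' := by
  classical
  unfold gtdMul
  rw [← Finsupp.sum_add]
  refine Finsupp.sum_congr fun p _ => ?_
  refine Finsupp.sum_add_index' (fun q => ?_) (fun q d d' => ?_)
  · simp
  · split_ifs
    · rw [← Finsupp.single_add, mul_add, add_mul]
    · simp

lemma gtdMul_single_single (p q : G × S) (c d : ℂ) :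
    gtdMul act α (Finsupp.single p c) (Finsupp.single q d) =
      if act p.2 q.1 = q.2 then
        Finsupp.single (p.1 * q.1, q.2) (c * d * (α p.1 q.1 q.2 : ℂ))
      else 0 := by
  unfold gtdMul
  rw [Finsupp.sum_single_index, Finsupp.sum_single_index] <;> simp

variable {act} (hact1 : ∀ s : S, act s 1 = s)
  (hact : ∀ (s : S) (g h : G), act (act s g) h = act s (g * h))

include hact1 hact in
lemma gtdMul_single_right_apply (w : (G × S) →₀ ℂ) (u q : G) (t s : S) (d : ℂ) :
    gtdMul act α w (Finsupp.single (u, t) d) (q, s) =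
      if s = t then d * (w (q * u⁻¹, act t u⁻¹) * α (q * u⁻¹) u t) else 0 := by
  classical
  induction w using Finsupp.induction_linear with
  | zero => simp [gtdMul_zero_left]
  | add f f' hf hf' =>
    rw [gtdMul_add_left, Finsupp.add_apply, hf, hf', Finsupp.add_apply]
    split_ifs <;> ring
  | single p c =>
    obtain ⟨p, z⟩ := p
    rw [gtdMul_single_single]
    simp only [act_eq_iff_eq_act_inv hact1 hact z t u]
    by_cases hst : s = t
    · subst hst
      by_cases hp : p = q * u⁻¹
      · subst hp
        by_cases hz : z = act s u⁻¹
        · simp [hz]; ring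
        · simp [hz]
      · have hq : p * u ≠ q := fun h => hp (eq_mul_inv_of_mul_eq h)
        by_cases hz : z = act s u⁻¹ <;>
          simp [hz, hp, hq]
    · by_cases hz : z = act t u⁻¹ <;> simp [hz, hst]

lemma gtdMul_single_left_apply (w : (G × S) →₀ ℂ) (u q : G) (t s : S) (d : ℂ) :
    gtdMul act α (Finsupp.single (u, t) d) w (q, s) =
      if act t (u⁻¹ * q) = s then d * (w (u⁻¹ * q, s) * α u (u⁻¹ * q) s) else 0 := by
  classical
  induction w using Finsupp.induction_linear with
  | zero => simp [gtdMul_zero_right]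
  | add f f' hf hf' =>
    rw [gtdMul_add_right, Finsupp.add_apply, hf, hf', Finsupp.add_apply]
    split_ifs <;> ring
  | single p c =>
    obtain ⟨p, z⟩ := p
    rw [gtdMul_single_single]
    by_cases hz : z = s <;> by_cases hp : p = u⁻¹ * q
    · subst hz hp
      by_cases h : act t (u⁻¹ * q) = z
      · simp [h]; ring
      · simp [h]
    all_goals
      have hne : (u * p, z) ≠ (q, s) := by
        rintro h
        obtain ⟨h1, h2⟩ := Prod.mk.inj h
        first | exact hz h2 | exact hp (eq_inv_mul_of_mul_eq h1)
      have hne' : (p, z) ≠ (u⁻¹ * q, s) := by simp [hz, hp]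
      dsimp only
      rw [Finsupp.single_eq_of_ne hne'.symm, zero_mul, mul_zero, ite_self]
      split_ifs
      · rw [Finsupp.single_eq_of_ne hne.symm]
      · rfl

include hact1 hact in
/-- An element `w` is central in `A_α(G,S)` iff it is supported on the `p ⊗ e(t)` with
`t·p = t`, and its coefficients are compatible with twisted conjugation. -/
lemma gtdMul_central_iff (hα1 : ∀ (g : G) (s : S), α g 1 s = 1) (w : (G × S) →₀ ℂ) :
    (∀ v : (G × S) →₀ ℂ, gtdMul act α w v = gtdMul act α v w) ↔
      (∀ p t, w (p, t) ≠ 0 → act t p = t) ∧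
      ∀ u p t, act t p = t →
        w (u * p * u⁻¹, act t u⁻¹) * α (u * p * u⁻¹) u t = w (p, t) * α u p t := by
  constructor
  · intro h
    have key : ∀ u q t s, _ := fun u q t s =>
      DFunLike.congr_fun (h (Finsupp.single (u, t) 1)) (q, s)
    simp only [gtdMul_single_right_apply α hact1 hact,
      gtdMul_single_left_apply] at key
    constructor
    · intro p t hp
      by_contra hne
      have := key 1 p t t
      simp [hact1, hα1, hne] at this
      exact hp this
    · intro u p t hpt
      simpa [hpt] using key u (u * p) t t
  · rintro ⟨hsupp, hconj⟩ v
    induction v using Finsupp.induction_linear with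
    | zero => rw [gtdMul_zero_left, gtdMul_zero_right]
    | add f f' hf hf' => rw [gtdMul_add_left, gtdMul_add_right, hf, hf']
    | single x d =>
      obtain ⟨u, t⟩ := x
      ext ⟨q, s⟩
      obtain ⟨p, rfl⟩ : ∃ p, q = u * p := ⟨u⁻¹ * q, by simp⟩
      rw [gtdMul_single_right_apply α hact1 hact, gtdMul_single_left_apply,
        inv_mul_cancel_left]
      by_cases hs : s = t
      · subst hs
        by_cases hp : act s p = s
        · simp [hp, hconj u p s hp]
        · have : w (u * p * u⁻¹, act s u⁻¹) = 0 := by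
            by_contra hne
            have := hsupp _ _ hne
            rw [hact, ← act_eq_iff_eq_act_inv hact1 hact, hact] at this
            simp [mul_assoc] at this
            exact hp this
          simp [hp, this]
      · rw [if_neg hs]
        split_ifs with hp
        · have : w (p, s) = 0 := by
            by_contra hne
            have h1 := hsupp _ _ hne
            rw [act_eq_iff_eq_act_inv hact1 hact] at hp h1
            exact hs (h1.trans hp.symm)
          simp [this]
        · rfl

end Multiplication

/-- The class sum `∑_{a∈L} ∑_i (g_i⁻¹ a g_i) ⊗ e(s·g_i)`. -/
noncomputable def gtdClassSum {G S : Type*} [Group G] (act : S → G → S) (s : S) {n : ℕ}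
    (g : Fin n → G) (L : Finset G) : (G × S) →₀ ℂ :=
  ∑ a ∈ L, ∑ i : Fin n, Finsupp.single ((g i)⁻¹ * a * g i, act s (g i)) 1

section ClassSum

variable {G S : Type*} [Group G] {act : S → G → S} {J : Type*} {sj : J → S}
  {k : J → ℕ} {g : ∀ j : J, Fin (k j) → G} {r : J → ℕ} {L : ∀ j : J, Fin (r j) → Finset G}

open Classical in
lemma gtdClassSum_apply (horb : ∀ t : S, ∃! j : J, ∃ x : G, act (sj j) x = t)
    (hcoset : ∀ (j : J) (x : G), ∃! i : Fin (k j), act (sj j) x = act (sj j) (g j i))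
    (p : Σ j : J, Fin (r j)) (j : J) (i : Fin (k j)) (b : G) :
    gtdClassSum act (sj p.1) (g p.1) (L p.1 p.2) ((g j i)⁻¹ * b * g j i, act (sj j) (g j i)) =
      if p.1 = j ∧ b ∈ L p.1 p.2 then 1 else 0 := by
  obtain ⟨j', T⟩ := p
  simp only [gtdClassSum, Finsupp.finsetSum_apply, Finsupp.single_apply, Prod.mk.injEq]
  by_cases hj : j' = j
  · subst hj
    have hi : ∀ i', act (sj j') (g j' i') = act (sj j') (g j' i) ↔ i' = i := fun i' =>
      ⟨fun h => (hcoset j' (g j' i')).unique rfl h, fun h => h ▸ rfl⟩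
    have : ∀ a, (∑ i', if (g j' i')⁻¹ * a * g j' i' = (g j' i)⁻¹ * b * g j' i ∧
        act (sj j') (g j' i') = act (sj j') (g j' i) then (1 : ℂ) else 0) =
        if a = b then 1 else 0 := by
      intro a
      rw [Finset.sum_eq_single i]
      · simp
      · intro i' _ hne
        simp [hi, hne]
      · simp
    simp [this]
  · have : ∀ i', act (sj j') (g j' i') ≠ act (sj j) (g j i) := fun i' h =>
      hj ((horb _).unique ⟨_, h⟩ ⟨_, rfl⟩)
    simp [this, hj]

lemma sum_smul_gtdClassSum_apply [Fintype J]
    (horb : ∀ t : S, ∃! j : J, ∃ x : G, act (sj j) x = t)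
    (hcoset : ∀ (j : J) (x : G), ∃! i : Fin (k j), act (sj j) x = act (sj j) (g j i))
    (hLdisj : ∀ j, ∀ t t' : Fin (r j), t ≠ t' → Disjoint (L j t) (L j t'))
    (c : (Σ j : J, Fin (r j)) → ℂ) (j : J) (i : Fin (k j)) (T : Fin (r j)) (b : G)
    (hb : b ∈ L j T) :
    (∑ p : Σ j : J, Fin (r j), c p • gtdClassSum act (sj p.1) (g p.1) (L p.1 p.2))
      ((g j i)⁻¹ * b * g j i, act (sj j) (g j i)) = c ⟨j, T⟩ := by
  classical
  simp only [Finsupp.finsetSum_apply, Finsupp.smul_apply, gtdClassSum_apply horb hcoset]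
  rw [Finset.sum_eq_single ⟨j, T⟩]
  · simp [hb]
  · rintro ⟨j', T'⟩ _ hne
    rw [if_neg, smul_zero]
    rintro ⟨h, hb'⟩
    dsimp only at h hb'
    subst h
    refine Finset.disjoint_left.1 (hLdisj j' T' T fun h => hne (h ▸ rfl)) hb' hb
  · simp

lemma exists_eq_conj_coset_rep (horb : ∀ t : S, ∃! j : J, ∃ x : G, act (sj j) x = t)
    (hcoset : ∀ (j : J) (x : G), ∃! i : Fin (k j), act (sj j) x = act (sj j) (g j i))
    (q : G) (t : S) :
    ∃ j i b, q = (g j i)⁻¹ * b * g j i ∧ t = act (sj j) (g j i) := by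
  obtain ⟨j, ⟨x, rfl⟩, -⟩ := horb t
  obtain ⟨i, hi, -⟩ := hcoset j x
  exact ⟨j, i, g j i * q * (g j i)⁻¹, by group, hi⟩

end ClassSum

/-- Let `s_j` (`j ∈ J`) be representatives of the `G`-orbits on `S`, with right coset
decompositions `G = ∪_{i=1}^{k_j} G_{s_j} g_{j,i}`, `g_{j,1} = 1`.  Under the
normality and compatibility assumptions on `α`, if for each `j` the sets
`L_1^j, …, L_{r_j}^j` are the `α_{s_j}`-regular conjugacy classes of `G_{s_j}`, then
the elements `Z(L_t^j) = ∑_{a∈L_t^j} ∑_i (g_{j,i}⁻¹ a g_{j,i}) ⊗ e(s_j·g_{j,i})`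
(`j ∈ J`, `1 ≤ t ≤ r_j`) form a `ℂ`-basis of the center `Z(A_α(G,S))`. -/
theorem stmt16 {G S : Type*} [Group G] [Fintype S] [DecidableEq S]
    (act : S → G → S)
    (hact1 : ∀ s : S, act s 1 = s)
    (hact : ∀ (s : S) (g h : G), act (act s g) h = act s (g * h))
    (α : G → G → S → ℂˣ)
    (hα1 : ∀ (g : G) (s : S), α g 1 s = 1) (hα1' : ∀ (g : G) (s : S), α 1 g s = 1)
    (hαc : ∀ (g h l : G) (s : S),
      α (g * h) l s * α g h (act s l⁻¹) = α g (h * l) s * α h l s)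
    {J : Type*} [Fintype J] (sj : J → S)
    (horb : ∀ t : S, ∃! j : J, ∃ x : G, act (sj j) x = t)
    (k : J → ℕ) [∀ j, NeZero (k j)] (g : ∀ j : J, Fin (k j) → G)
    (hg1 : ∀ j : J, g j 0 = 1)
    (hcoset : ∀ (j : J) (x : G), ∃! i : Fin (k j), act (sj j) x = act (sj j) (g j i))
    (hnorm : ∀ (t : S) (x a : G), act t x = t → act t a = t → IsRegAt act α t a →
      α x a t = α (x * a * x⁻¹) x t)
    (hcompat : ∀ (j : J) (i i' : Fin (k j)) (h a : G),
      act (sj j) h = sj j → act (sj j) a = sj j → IsRegAt act α (sj j) a →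
      α ((g j i')⁻¹ * h * g j i) ((g j i)⁻¹ * a * g j i) (act (sj j) (g j i))
        = α ((g j i')⁻¹ * (h * a * h⁻¹) * g j i') ((g j i')⁻¹ * h * g j i)
            (act (sj j) (g j i)))
    -- for each `j`, the `L j 1, …, L j (r j)` are the `α_{s_j}`-regular conjugacy
    -- classes of `G_{s_j}`
    (r : J → ℕ) (L : ∀ j : J, Fin (r j) → Finset G)
    (hLs : ∀ j t, ∀ a ∈ L j t, act (sj j) a = sj j)
    (hLreg : ∀ j t, ∀ a ∈ L j t, IsRegAt act α (sj j) a)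
    (hLconj : ∀ j t, ∃ a₀ ∈ L j t, ∀ b : G,
      b ∈ L j t ↔ ∃ h : G, act (sj j) h = sj j ∧ b = h * a₀ * h⁻¹)
    (hLdisj : ∀ j, ∀ t t' : Fin (r j), t ≠ t' → Disjoint (L j t) (L j t'))
    (hLcover : ∀ (j : J) (a : G), act (sj j) a = sj j → IsRegAt act α (sj j) a →
      ∃ t, a ∈ L j t) :
    -- the `Z(L_t^j)` are linearly independent and span exactly the center of `A_α(G,S)`
    LinearIndependent ℂ (fun p : Σ j : J, Fin (r j) =>
      ∑ a ∈ L p.1 p.2, ∑ i : Fin (k p.1),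
        Finsupp.single ((g p.1 i)⁻¹ * a * g p.1 i, act (sj p.1) (g p.1 i)) (1 : ℂ)) ∧
    ∀ w : (G × S) →₀ ℂ,
      (∀ v : (G × S) →₀ ℂ, gtdMul act α w v = gtdMul act α v w) ↔
      w ∈ Submodule.span ℂ
        (Set.range fun p : Σ j : J, Fin (r j) =>
          ∑ a ∈ L p.1 p.2, ∑ i : Fin (k p.1),
            Finsupp.single ((g p.1 i)⁻¹ * a * g p.1 i, act (sj p.1) (g p.1 i)) (1 : ℂ)) := by
  classical
  have hstab : ∀ (s : S) (u b : G), act (act s u) (u⁻¹ * b * u) = act s u ↔ act s b = s := by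
    intro s u b
    rw [hact, show u * (u⁻¹ * b * u) = b * u by group, ← hact,
      act_eq_iff_eq_act_inv hact1 hact, hact, mul_inv_cancel, hact1]
  have hLmem : ∀ j t h b, act (sj j) h = sj j → (h * b * h⁻¹ ∈ L j t ↔ b ∈ L j t) := by
    intro j t h b hh
    have hh' : act (sj j) h⁻¹ = sj j :=
      ((act_eq_iff_eq_act_inv hact1 hact _ _ _).1 hh).symm
    obtain ⟨a₀, -, hL⟩ := hLconj j t
    rw [hL, hL]
    constructor
    · rintro ⟨x, hx, hb⟩
      refine ⟨h⁻¹ * x, by rw [← hact, hh', hx], ?_⟩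
      rw [show b = h⁻¹ * (h * b * h⁻¹) * h by group, hb]
      group
    · rintro ⟨x, hx, rfl⟩
      exact ⟨h * x, by rw [← hact, hh, hx], by group⟩
  change LinearIndependent ℂ (fun p : Σ j : J, Fin (r j) =>
      gtdClassSum act (sj p.1) (g p.1) (L p.1 p.2)) ∧
    ∀ w : (G × S) →₀ ℂ, _ ↔ w ∈ Submodule.span ℂ (Set.range fun p : Σ j : J, Fin (r j) =>
      gtdClassSum act (sj p.1) (g p.1) (L p.1 p.2))
  constructor
  · rw [Fintype.linearIndependent_iff]
    rintro c hc ⟨j, T⟩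
    obtain ⟨a₀, ha₀, -⟩ := hLconj j T
    rw [← sum_smul_gtdClassSum_apply horb hcoset hLdisj c j 0 T a₀ ha₀, hc,
      Finsupp.zero_apply]
  intro w
  rw [gtdMul_central_iff α hact1 hact hα1]
  constructor
  · rintro ⟨hsupp, hconj⟩
    choose a ha haL using fun p : Σ j : J, Fin (r j) => hLconj p.1 p.2
    have hreg : ∀ b t, w (b, t) ≠ 0 → IsRegAt act α t b := by
      intro b t hb z hz hzb
      have h := hconj z b t (hsupp b t hb)
      rw [hzb, mul_inv_cancel_right, ← (act_eq_iff_eq_act_inv hact1 hact _ _ _).1 hz] at h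
      exact Units.ext (mul_left_cancel₀ hb h)
    have hrep : ∀ j i b, act (sj j) b = sj j → IsRegAt act α (sj j) b →
        w ((g j i)⁻¹ * b * g j i, act (sj j) (g j i)) = w (b, sj j) := by
      intro j i b hb hbr
      have h := hconj (g j i)⁻¹ b (sj j) hb
      have hα := hcompat j 0 i 1 b (hact1 _) hb hbr
      simp only [hg1, hact1, mul_one, inv_one, one_mul] at hα
      rw [inv_inv, hα] at h
      exact mul_right_cancel₀ (Units.ne_zero _) h
    have hclass : ∀ p : Σ j : J, Fin (r j), ∀ b ∈ L p.1 p.2,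
        w (b, sj p.1) = w (a p, sj p.1) := by
      intro p b hb
      obtain ⟨x, hx, rfl⟩ := (haL p b).1 hb
      have h := hconj x (a p) (sj p.1) (hLs _ _ _ (ha p))
      rw [← (act_eq_iff_eq_act_inv hact1 hact _ _ _).1 hx,
        hnorm _ x (a p) hx (hLs _ _ _ (ha p)) (hLreg _ _ _ (ha p))] at h
      exact mul_right_cancel₀ (Units.ne_zero _) h
    have hw : w = ∑ p : Σ j : J, Fin (r j), w (a p, sj p.1) •
        gtdClassSum act (sj p.1) (g p.1) (L p.1 p.2) := by
      ext ⟨q, t⟩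
      obtain ⟨j, i, b, rfl, rfl⟩ := exists_eq_conj_coset_rep horb hcoset q t
      by_cases hb : ∃ T, b ∈ L j T
      · obtain ⟨T, hT⟩ := hb
        rw [sum_smul_gtdClassSum_apply horb hcoset hLdisj _ j i T b hT,
          hrep j i b (hLs j T b hT) (hLreg j T b hT), hclass ⟨j, T⟩ b hT]
      · have h0 : ∀ p : Σ j : J, Fin (r j), ¬ (p.1 = j ∧ b ∈ L p.1 p.2) := by
          rintro ⟨_, T⟩ ⟨rfl, hT⟩
          exact hb ⟨T, hT⟩
        simp only [Finsupp.finsetSum_apply, Finsupp.smul_apply,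
          gtdClassSum_apply horb hcoset, if_neg (h0 _), smul_zero, Finset.sum_const_zero]
        by_contra hne
        have hbs := (hstab _ _ _).1 (hsupp _ _ hne)
        refine hb (hLcover j b hbs (hreg b _ fun hb0 => hne ?_))
        have h := hconj (g j i)⁻¹ b (sj j) hbs
        rw [inv_inv, hb0, zero_mul] at h
        exact (mul_eq_zero.1 h).resolve_right (Units.ne_zero _)
    rw [hw]
    exact Submodule.sum_mem _ fun p _ =>
      Submodule.smul_mem _ _ (Submodule.subset_span ⟨p, rfl⟩)
  · intro hw
    induction hw using Submodule.span_induction with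
    | mem x hx =>
      obtain ⟨⟨j', T⟩, rfl⟩ := hx
      constructor
      · intro q t hq
        obtain ⟨j, i, b, rfl, rfl⟩ := exists_eq_conj_coset_rep horb hcoset q t
        rw [gtdClassSum_apply horb hcoset] at hq
        obtain ⟨h, hb⟩ := (ite_ne_right_iff.1 hq).1
        dsimp only at h hb
        subst h
        exact (hstab _ _ _).2 (hLs _ _ _ hb)
      · intro u q t hq
        obtain ⟨j, i, b, rfl, rfl⟩ := exists_eq_conj_coset_rep horb hcoset q t
        obtain ⟨i', hi', -⟩ := hcoset j (g j i * u⁻¹)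
        obtain ⟨h, rfl⟩ : ∃ h, u = (g j i')⁻¹ * h * g j i :=
          ⟨g j i' * u * (g j i)⁻¹, by group⟩
        have hh : act (sj j) h = sj j := by
          rw [show g j i * ((g j i')⁻¹ * h * g j i)⁻¹ = h⁻¹ * g j i' by group, ← hact,
            act_eq_iff_eq_act_inv hact1 hact, hact, mul_inv_cancel, hact1] at hi'
          exact (act_eq_iff_eq_act_inv hact1 hact _ _ _).2 hi'.symm
        have hu : (g j i')⁻¹ * h * g j i * ((g j i)⁻¹ * b * g j i) *
            ((g j i')⁻¹ * h * g j i)⁻¹ = (g j i')⁻¹ * (h * b * h⁻¹) * g j i' := by group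
        rw [hact, hi', hu, gtdClassSum_apply horb hcoset, gtdClassSum_apply horb hcoset]
        by_cases hb : j' = j ∧ b ∈ L j' T
        · obtain ⟨rfl, hb⟩ := hb
          rw [hcompat j' i i' h b hh (hLs _ _ _ hb) (hLreg _ _ _ hb)]
          simp [hb, hLmem j' T h b hh]
        · have hb' : ¬ (j' = j ∧ h * b * h⁻¹ ∈ L j' T) := by
            rintro ⟨rfl, hb'⟩
            exact hb ⟨rfl, (hLmem j' T h b hh).1 hb'⟩
          simp only [if_neg hb, if_neg hb', zero_mul]
    | zero => simp
    | add x y _ _ hx hy =>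
      refine ⟨fun p t hp => ?_, fun u p t hp => ?_⟩
      · by_cases hxp : x (p, t) = 0
        · refine hy.1 p t fun hyp => hp ?_
          rw [Finsupp.add_apply, hxp, hyp, add_zero]
        · exact hx.1 p t hxp
      · rw [Finsupp.add_apply, Finsupp.add_apply, add_mul, add_mul, hx.2 u p t hp,
          hy.2 u p t hp]
    | smul c x _ hx =>
      refine ⟨fun p t hp => hx.1 p t fun h => hp ?_, fun u p t hp => ?_⟩
      · rw [Finsupp.smul_apply, h, smul_zero]
      · rw [Finsupp.smul_apply, Finsupp.smul_apply, smul_eq_mul, smul_eq_mul, mul_assoc,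
          hx.2 u p t hp, mul_assoc]
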